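/- Let p ∈ (1, ∞). There exists C = C(p) > 0 such that for every nonnegative ω ∈ L¹ ∩ L^p(ℝ²₊) with x₂ω ∈ L¹(ℝ²₊), the kinetic energy E(ω) := (1/2) ∫_{ℝ²₊} ∫_{ℝ²₊} G(x, y) ω(x) ω(y) dx dy satisfies E(ω) ≤ C · ‖x₂ω‖_{L¹}^{1 − 1/p} · ‖ω‖_{L¹}^{1/2 + 1/p} · ‖ω‖_{L^p}^{1/2}. -/

import Mathlib

open MeasureTheory Real Set

noncomputable def G (x y : ℝ × ℝ) : ℝ :=
  (1 / (4 * π)) * Real.log (1 + 4 * x.2 * y.2 / ((x.1 - y.1)^2 + (x.2 - y.2)^2))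

def upperHalf : Set (ℝ × ℝ) := {y : ℝ × ℝ | 0 < y.2}

noncomputable def energy (ω : ℝ × ℝ → ℝ) : ℝ :=
  (1/2) * ∫ x in upperHalf, ∫ y in upperHalf, G x y * ω x * ω y

lemma measurableSet_upperHalf : MeasurableSet upperHalf :=
  measurableSet_lt measurable_const measurable_snd

lemma log_one_add_le_rpow_div {t b : ℝ} (ht : 0 ≤ t) (hb : 0 < b) (hb1 : b ≤ 1) :
    Real.log (1 + t) ≤ t ^ b / b := by
  have h1 : (1 + t) ^ b ≤ 1 + t ^ b := by
    simpa using Real.rpow_add_le_add_rpow zero_le_one ht hb.le hb1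
  have h2 : b * Real.log (1 + t) ≤ t ^ b := by
    rw [← Real.log_rpow (by linarith)]
    have h3 : 0 < (1 + t) ^ b := by positivity
    linarith [Real.log_le_sub_one_of_pos h3]
  rw [le_div_iff₀ hb]
  linarith

lemma log_one_add_le_of_le_mul {t u a : ℝ} (ht : 0 ≤ t) (hu : 0 ≤ u) (ha : 0 < a) (ha1 : a ≤ 1)
    (htu : t ≤ 8 * u ∨ t ≤ 8 * u ^ 2) : Real.log (1 + t) ≤ 16 / a * u ^ a := by
  rcases htu with h | h
  · calc Real.log (1 + t) ≤ t ^ a / a := log_one_add_le_rpow_div ht ha ha1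
      _ ≤ (8 * u) ^ a / a := by gcongr
      _ = 8 ^ a * u ^ a / a := by rw [Real.mul_rpow (by norm_num) hu]
      _ ≤ 16 * u ^ a / a := by
        have : (8 : ℝ) ^ a ≤ 8 ^ (1 : ℝ) := by gcongr; norm_num
        rw [Real.rpow_one] at this
        gcongr
        linarith
      _ = _ := by ring
  · calc Real.log (1 + t) ≤ t ^ (a / 2) / (a / 2) :=
        log_one_add_le_rpow_div ht (by linarith) (by linarith)
      _ ≤ (8 * u ^ 2) ^ (a / 2) / (a / 2) := by gcongr
      _ = 8 ^ (a / 2) * u ^ a / (a / 2) := by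
        rw [Real.mul_rpow (by norm_num) (by positivity), ← Real.rpow_natCast u 2,
          ← Real.rpow_mul hu]
        congr 3
        push_cast
        ring
      _ ≤ 8 * u ^ a / (a / 2) := by
        have : (8 : ℝ) ^ (a / 2) ≤ 8 ^ (1 : ℝ) := by
          gcongr
          · norm_num
          · linarith
        rw [Real.rpow_one] at this
        gcongr
      _ = _ := by ring

lemma G_nonneg {x y : ℝ × ℝ} (hx : 0 < x.2) (hy : 0 < y.2) : 0 ≤ G x y := by
  unfold G
  have : 0 ≤ 4 * x.2 * y.2 / ((x.1 - y.1) ^ 2 + (x.2 - y.2) ^ 2) := by positivity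
  exact mul_nonneg (by positivity) (Real.log_nonneg (by linarith))

lemma sq_norm_sub_le (x y : ℝ × ℝ) :
    ‖x - y‖ ^ 2 ≤ (x.1 - y.1) ^ 2 + (x.2 - y.2) ^ 2 := by
  rw [Prod.norm_def]
  rcases max_choice ‖(x - y).1‖ ‖(x - y).2‖ with h | h <;> rw [h] <;>
    simp only [Prod.fst_sub, Prod.snd_sub, Real.norm_eq_abs, sq_abs] <;> nlinarith

lemma G_le_rpow {x y : ℝ × ℝ} {a : ℝ} (hx : 0 < x.2) (hy : 0 < y.2) (ha : 0 < a) (ha1 : a ≤ 1) :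
    G x y ≤ 16 / a * x.2 ^ a * ‖x - y‖ ^ (-a) := by
  rcases eq_or_ne x y with rfl | hxy
  · simp only [G, sub_self]
    norm_num
    positivity
  have hs : 0 < ‖x - y‖ := norm_pos_iff.2 (sub_ne_zero.2 hxy)
  have hsq := sq_norm_sub_le x y
  have hy2 : y.2 ≤ x.2 + ‖x - y‖ := by
    have h1 : ‖(x - y).2‖ ≤ ‖x - y‖ := norm_snd_le _
    rw [Prod.snd_sub, Real.norm_eq_abs] at h1
    linarith [neg_abs_le (x.2 - y.2)]
  set s := ‖x - y‖
  have hts : 4 * x.2 * y.2 / ((x.1 - y.1) ^ 2 + (x.2 - y.2) ^ 2) ≤ 4 * x.2 * y.2 / s ^ 2 := by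
    gcongr
  have hlog : Real.log (1 + 4 * x.2 * y.2 / ((x.1 - y.1) ^ 2 + (x.2 - y.2) ^ 2)) ≤
      16 / a * (x.2 / s) ^ a := by
    refine log_one_add_le_of_le_mul (by positivity) (by positivity) ha ha1 ?_
    rcases le_total x.2 s with h | h
    · left
      refine hts.trans ?_
      rw [← mul_div_assoc, div_le_div_iff₀ (by positivity) hs]
      have : x.2 * s * y.2 ≤ x.2 * s * (2 * s) := by gcongr; linarith
      nlinarith
    · right
      refine hts.trans ?_
      rw [div_pow, ← mul_div_assoc, div_le_div_iff_of_pos_right (by positivity)]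
      nlinarith
  have hpi : 1 / (4 * π) ≤ 1 := by
    rw [div_le_one (by positivity)]
    linarith [Real.pi_gt_three]
  calc G x y ≤ 1 * (16 / a * (x.2 / s) ^ a) := by
        unfold G
        gcongr
        exact Real.log_nonneg (le_add_of_nonneg_right (by positivity))
    _ = _ := by
      rw [Real.div_rpow hx.le hs.le, Real.rpow_neg hs.le]
      ring

/-- The kernel `s ↦ s ^ (-a)` cut off at radius `R`. -/
noncomputable def truncatedRpow (a R : ℝ) : ℝ → ℝ := (Iio R).indicator fun s => s ^ (-a)

lemma truncatedRpow_nonneg (a R : ℝ) {s : ℝ} (hs : 0 ≤ s) : 0 ≤ truncatedRpow a R s := by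
  unfold truncatedRpow
  by_cases h : s ∈ Iio R
  · rw [indicator_of_mem h]
    positivity
  · rw [indicator_of_notMem h]

lemma measurable_truncatedRpow (a R : ℝ) : Measurable (truncatedRpow a R) :=
  Measurable.indicator (by fun_prop) measurableSet_Iio

lemma rpow_neg_le_add_truncatedRpow {a R s : ℝ} (ha : 0 < a) (hR : 0 < R) :
    s ^ (-a) ≤ R ^ (-a) + truncatedRpow a R s := by
  unfold truncatedRpow
  by_cases h : s ∈ Iio R
  · rw [indicator_of_mem h]
    have : 0 < R ^ (-a) := by positivity
    linarith
  · rw [indicator_of_notMem h, add_zero]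
    exact Real.rpow_le_rpow_of_nonpos hR (not_lt.1 h) (by linarith)

lemma mul_truncatedRpow_rpow {a R s : ℝ} (ha : 0 < a) (hs : 0 < s) :
    s * truncatedRpow a R s ^ (1 / a) = (Iio R).indicator (fun _ => 1) s := by
  unfold truncatedRpow
  by_cases h : s ∈ Iio R
  · rw [indicator_of_mem h, indicator_of_mem h, ← Real.rpow_mul hs.le]
    rw [show -a * (1 / a) = -1 by field_simp, Real.rpow_neg_one]
    field_simp
  · rw [indicator_of_notMem h, indicator_of_notMem h, Real.zero_rpow (by positivity), mul_zero]

lemma integrable_truncatedRpow_norm {a R : ℝ} (ha : 0 < a) :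
    Integrable (fun z : ℝ × ℝ => truncatedRpow a R ‖z‖ ^ (1 / a)) := by
  have : (volume : Measure (ℝ × ℝ)).IsAddHaarMeasure := Measure.prod.instIsAddHaarMeasure _ _
  rw [integrable_fun_norm_addHaar volume (f := fun s => truncatedRpow a R s ^ (1 / a))]
  have h : EqOn (fun s : ℝ => (Iio R).indicator (fun _ => (1 : ℝ)) s)
      (fun y : ℝ => y ^ (Module.finrank ℝ (ℝ × ℝ) - 1) • truncatedRpow a R y ^ (1 / a))
      (Ioi 0) := by
    intro s hs
    simp [← mul_truncatedRpow_rpow (R := R) ha hs]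
  refine IntegrableOn.congr_fun ?_ h measurableSet_Ioi
  rw [IntegrableOn, integrable_indicator_iff measurableSet_Iio, IntegrableOn,
    Measure.restrict_restrict measurableSet_Iio, ← IntegrableOn, inter_comm, Ioi_inter_Iio]
  exact integrableOn_const (by simp)

lemma integral_truncatedRpow_norm {a R : ℝ} (ha : 0 < a) (hR : 0 < R) :
    ∫ z : ℝ × ℝ, truncatedRpow a R ‖z‖ ^ (1 / a) =
      2 * volume.real (Metric.ball (0 : ℝ × ℝ) 1) * R := by
  have : (volume : Measure (ℝ × ℝ)).IsAddHaarMeasure := Measure.prod.instIsAddHaarMeasure _ _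
  rw [integral_fun_norm_addHaar volume (fun s => truncatedRpow a R s ^ (1 / a))]
  have h : EqOn (fun y : ℝ => y ^ (Module.finrank ℝ (ℝ × ℝ) - 1) • truncatedRpow a R y ^ (1 / a))
      (fun s : ℝ => (Iio R).indicator (fun _ => (1 : ℝ)) s) (Ioi 0) := by
    intro s hs
    simp [← mul_truncatedRpow_rpow (R := R) ha hs]
  rw [setIntegral_congr_fun measurableSet_Ioi h, integral_indicator measurableSet_Iio,
    Measure.restrict_restrict measurableSet_Iio, inter_comm, Ioi_inter_Iio]
  simp [hR.le, mul_assoc]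

lemma memLp_ofReal_of_integrable_rpow {α : Type*} [MeasurableSpace α] {μ : Measure α} {p : ℝ}
    (hp : 0 < p) {f : α → ℝ} (hf0 : ∀ᵐ y ∂μ, 0 ≤ f y) (hf : AEStronglyMeasurable f μ)
    (hint : Integrable (fun y => f y ^ p) μ) : MemLp f (ENNReal.ofReal p) μ := by
  rw [← integrable_norm_rpow_iff hf (by simpa using hp) ENNReal.ofReal_ne_top,
    ENNReal.toReal_ofReal hp.le]
  refine hint.congr (hf0.mono fun y hy => ?_)
  simp only [Real.norm_of_nonneg hy]

/-- Splitting the Riesz-type potential of `ω` at radius `R`. -/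
lemma integral_norm_rpow_mul_le {p : ℝ} (hp : 1 < p) {ω : ℝ × ℝ → ℝ} {S : Set (ℝ × ℝ)}
    (hω : ∀ y, 0 ≤ ω y) (h1 : IntegrableOn ω S) (h2 : IntegrableOn (fun y => ω y ^ p) S)
    (x : ℝ × ℝ) {R : ℝ} (hR : 0 < R) :
    IntegrableOn (fun y => ‖x - y‖ ^ (-(1 - 1 / p)) * ω y) S ∧
    ∫ y in S, ‖x - y‖ ^ (-(1 - 1 / p)) * ω y ≤
      R ^ (-(1 - 1 / p)) * (∫ y in S, ω y) +
      (2 * volume.real (Metric.ball (0 : ℝ × ℝ) 1) * R) ^ (1 - 1 / p) *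
        (∫ y in S, ω y ^ p) ^ (1 / p) := by
  have ha : 0 < 1 - 1 / p := by
    rw [sub_pos, div_lt_one (by linarith)]
    exact hp
  set a := 1 - 1 / p with ha_def
  have hpos : 0 < p := by linarith
  have hconj : (1 / a).HolderConjugate p := by
    rw [Real.holderConjugate_iff]
    constructor
    · rw [lt_div_iff₀ ha, ha_def]
      have : 0 < 1 / p := by positivity
      linarith
    · rw [one_div, inv_inv, ha_def]
      ring
  set k : ℝ × ℝ → ℝ := fun y => truncatedRpow a R ‖x - y‖ with hk_def
  have hk0 : ∀ y, 0 ≤ k y := fun y => truncatedRpow_nonneg a R (norm_nonneg _)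
  have hkm : Measurable k := (measurable_truncatedRpow a R).comp (by fun_prop)
  have hkint : Integrable (fun y => k y ^ (1 / a)) :=
    (integrable_truncatedRpow_norm ha).comp_sub_left x
  have hkval : ∫ y, k y ^ (1 / a) = 2 * volume.real (Metric.ball (0 : ℝ × ℝ) 1) * R := by
    rw [← integral_truncatedRpow_norm ha hR]
    exact integral_sub_left_eq_self (fun z : ℝ × ℝ => truncatedRpow a R ‖z‖ ^ (1 / a)) volume x
  have hkLp : MemLp k (ENNReal.ofReal (1 / a)) (volume.restrict S) :=
    memLp_ofReal_of_integrable_rpow (by positivity) (.of_forall hk0) hkm.aestronglyMeasurable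
      hkint.integrableOn
  have hωLp : MemLp ω (ENNReal.ofReal p) (volume.restrict S) :=
    memLp_ofReal_of_integrable_rpow hpos (.of_forall hω) h1.aestronglyMeasurable h2
  have hkω : IntegrableOn (fun y => k y * ω y) S := by
    have := hconj.ennrealOfReal
    exact hkLp.integrable_mul hωLp
  have hg : IntegrableOn (fun y => R ^ (-a) * ω y + k y * ω y) S :=
    (h1.const_mul _).add hkω
  have hle : ∀ y, ‖x - y‖ ^ (-a) * ω y ≤ R ^ (-a) * ω y + k y * ω y := by
    intro y
    rw [← add_mul]
    exact mul_le_mul_of_nonneg_right (rpow_neg_le_add_truncatedRpow ha hR) (hω y)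
  have h0 : ∀ y, 0 ≤ ‖x - y‖ ^ (-a) * ω y := fun y => mul_nonneg (by positivity) (hω y)
  have hf : IntegrableOn (fun y => ‖x - y‖ ^ (-a) * ω y) S := by
    refine hg.mono' ?_ (.of_forall fun y => ?_)
    · have hm : Measurable fun y : ℝ × ℝ => ‖x - y‖ ^ (-a) := by fun_prop
      exact hm.aestronglyMeasurable.mul h1.aestronglyMeasurable
    · rw [Real.norm_of_nonneg (h0 y)]
      exact hle y
  refine ⟨hf, (integral_mono hf hg hle).trans ?_⟩
  rw [integral_add (h1.const_mul _) hkω, integral_const_mul]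
  gcongr
  have hH := integral_mul_le_Lp_mul_Lq_of_nonneg hconj (.of_forall hk0) (.of_forall hω) hkLp hωLp
  rw [one_div_one_div] at hH
  refine hH.trans ?_
  gcongr
  · exact Real.rpow_nonneg (integral_nonneg fun y => Real.rpow_nonneg (hω y) _) _
  · exact integral_nonneg fun y => Real.rpow_nonneg (hk0 y) _
  · rw [← hkval]
    exact setIntegral_le_integral hkint (.of_forall fun y => Real.rpow_nonneg (hk0 y) _)

/-- Optimising `R ^ (-a) * N + (D * R) ^ a * M` over the radius `R`. -/
lemma exists_radius_balance {a D N M : ℝ} (ha : 0 < a) (hD : 0 ≤ D) (hN : 0 < N) (hM : 0 < M) :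
    ∃ R : ℝ, 0 < R ∧ R ^ (-a) * N + (D * R) ^ a * M =
      (1 + D ^ a) * (N ^ (1 / 2 : ℝ) * M ^ (1 / 2 : ℝ)) := by
  refine ⟨(N ^ (1 / 2 : ℝ) / M ^ (1 / 2 : ℝ)) ^ (1 / a), by positivity, ?_⟩
  have hR : ((N ^ (1 / 2 : ℝ) / M ^ (1 / 2 : ℝ)) ^ (1 / a)) ^ a =
      N ^ (1 / 2 : ℝ) / M ^ (1 / 2 : ℝ) := by
    rw [← Real.rpow_mul (by positivity), one_div_mul_cancel ha.ne', Real.rpow_one]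
  have sq_half : ∀ {t : ℝ}, 0 < t → t = t ^ (1 / 2 : ℝ) * t ^ (1 / 2 : ℝ) := by
    intro t ht
    rw [← Real.rpow_add ht]
    norm_num
  have hNs := sq_half hN
  have hMs := sq_half hM
  rw [Real.rpow_neg (by positivity), Real.mul_rpow hD (by positivity), hR]
  have hn : 0 < N ^ (1 / 2 : ℝ) := by positivity
  have hm : 0 < M ^ (1 / 2 : ℝ) := by positivity
  set n := N ^ (1 / 2 : ℝ)
  set m := M ^ (1 / 2 : ℝ)
  rw [hNs, hMs]
  field_simp

lemma integral_norm_rpow_mul_le_sqrt {p : ℝ} (hp : 1 < p) {ω : ℝ × ℝ → ℝ} {S : Set (ℝ × ℝ)}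
    (hω : ∀ y, 0 ≤ ω y) (h1 : IntegrableOn ω S) (h2 : IntegrableOn (fun y => ω y ^ p) S)
    (hN : 0 < ∫ y in S, ω y) (hM : 0 < ∫ y in S, ω y ^ p) (x : ℝ × ℝ) :
    ∫ y in S, ‖x - y‖ ^ (-(1 - 1 / p)) * ω y ≤
      (1 + (2 * volume.real (Metric.ball (0 : ℝ × ℝ) 1)) ^ (1 - 1 / p)) *
        ((∫ y in S, ω y) ^ (1 / 2 : ℝ) * ((∫ y in S, ω y ^ p) ^ (1 / p)) ^ (1 / 2 : ℝ)) := by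
  have ha : 0 < 1 - 1 / p := by
    rw [sub_pos, div_lt_one (by linarith)]
    exact hp
  obtain ⟨R, hR, h⟩ := exists_radius_balance
    (D := 2 * volume.real (Metric.ball (0 : ℝ × ℝ) 1)) ha (by positivity) hN
    (Real.rpow_pos_of_pos hM (1 / p))
  rw [← h]
  exact (integral_norm_rpow_mul_le hp hω h1 h2 x hR).2

lemma integrableOn_snd_rpow_mul {a : ℝ} (ha : 0 ≤ a) (ha1 : a ≤ 1) {ω : ℝ × ℝ → ℝ}
    (hω : ∀ y, 0 ≤ ω y) (h1 : IntegrableOn ω upperHalf)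
    (h3 : IntegrableOn (fun y => y.2 * ω y) upperHalf) :
    IntegrableOn (fun y => y.2 ^ a * ω y) upperHalf := by
  refine (h1.add h3).mono' ?_
    ((ae_restrict_mem measurableSet_upperHalf).mono fun y (hy : 0 < y.2) => ?_)
  · have hm : Measurable fun y : ℝ × ℝ => y.2 ^ a := by fun_prop
    exact hm.aestronglyMeasurable.mul h1.aestronglyMeasurable
  · rw [Real.norm_of_nonneg (mul_nonneg (by positivity) (hω y))]
    have h : y.2 ^ a ≤ 1 + y.2 := by
      rcases le_total y.2 1 with h | h
      · linarith [Real.rpow_le_one hy.le h ha]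
      · linarith [Real.rpow_le_self_of_one_le h ha1]
    calc y.2 ^ a * ω y ≤ (1 + y.2) * ω y := mul_le_mul_of_nonneg_right h (hω y)
      _ = _ := by simp [add_mul]

lemma integral_snd_rpow_mul_le {p : ℝ} (hp : 1 < p) {ω : ℝ × ℝ → ℝ}
    (hω : ∀ y, 0 ≤ ω y) (h1 : IntegrableOn ω upperHalf)
    (h3 : IntegrableOn (fun y => y.2 * ω y) upperHalf) :
    ∫ y in upperHalf, y.2 ^ (1 - 1 / p) * ω y ≤
      (∫ y in upperHalf, y.2 * ω y) ^ (1 - 1 / p) * (∫ y in upperHalf, ω y) ^ (1 / p) := by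
  have hpos : 0 < p := by linarith
  have ha : 0 < 1 - 1 / p := by
    rw [sub_pos, div_lt_one (by linarith)]
    exact hp
  have hap : 1 - 1 / p + 1 / p = 1 := by ring
  set a := 1 - 1 / p
  have hconj : (1 / a).HolderConjugate p := by
    rw [Real.holderConjugate_iff]
    constructor
    · rw [lt_div_iff₀ ha]
      have : 0 < 1 / p := by positivity
      linarith
    · rw [one_div, inv_inv, ← hap, one_div]
  have hf0 : ∀ᵐ y ∂volume.restrict upperHalf, 0 ≤ (y.2 * ω y) ^ a :=
    (ae_restrict_mem measurableSet_upperHalf).mono fun y (hy : 0 < y.2) =>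
      Real.rpow_nonneg (mul_nonneg hy.le (hω y)) _
  have hg0 : ∀ y, 0 ≤ ω y ^ (1 / p) := fun y => Real.rpow_nonneg (hω y) _
  have hfpow : ∀ y ∈ upperHalf, ((y.2 * ω y) ^ a) ^ (1 / a) = y.2 * ω y := by
    intro y (hy : 0 < y.2)
    rw [← Real.rpow_mul (mul_nonneg hy.le (hω y)), mul_one_div_cancel ha.ne', Real.rpow_one]
  have hgpow : ∀ y, (ω y ^ (1 / p)) ^ p = ω y := by
    intro y
    rw [← Real.rpow_mul (hω y), one_div_mul_cancel hpos.ne', Real.rpow_one]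
  have hfLp : MemLp (fun y : ℝ × ℝ => (y.2 * ω y) ^ a) (ENNReal.ofReal (1 / a))
      (volume.restrict upperHalf) := by
    refine memLp_ofReal_of_integrable_rpow (by positivity) hf0
      (h3.aemeasurable.pow_const a).aestronglyMeasurable ?_
    exact IntegrableOn.congr_fun h3 (fun y hy => (hfpow y hy).symm) measurableSet_upperHalf
  have hgLp : MemLp (fun y : ℝ × ℝ => ω y ^ (1 / p)) (ENNReal.ofReal p)
      (volume.restrict upperHalf) := by
    refine memLp_ofReal_of_integrable_rpow hpos (.of_forall hg0)
      (h1.aemeasurable.pow_const _).aestronglyMeasurable ?_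
    simp only [hgpow]
    exact h1
  have hH := integral_mul_le_Lp_mul_Lq_of_nonneg hconj hf0 (.of_forall hg0) hfLp hgLp
  rw [one_div_one_div, setIntegral_congr_fun measurableSet_upperHalf hfpow] at hH
  simp only [hgpow] at hH
  refine le_trans (le_of_eq ?_) hH
  refine setIntegral_congr_fun measurableSet_upperHalf fun y (hy : 0 < y.2) => ?_
  rw [Real.mul_rpow hy.le (hω y), mul_assoc, ← Real.rpow_add_of_nonneg (hω y) ha.le
    (by positivity), hap, Real.rpow_one]

lemma energy_eq_zero {ω : ℝ × ℝ → ℝ} (h : ∀ᵐ y ∂volume.restrict upperHalf, ω y = 0) :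
    energy ω = 0 := by
  have : ∀ x, ∫ y in upperHalf, G x y * ω x * ω y = 0 := fun x =>
    integral_eq_zero_of_ae (h.mono fun y hy => by simp [hy])
  simp [energy, this]

lemma energy_le_of_potential_le {a K : ℝ} (ha : 0 < a) (ha1 : a ≤ 1) {ω : ℝ × ℝ → ℝ}
    (hω : ∀ y, 0 ≤ ω y) (h1 : IntegrableOn ω upperHalf)
    (h3 : IntegrableOn (fun y => y.2 * ω y) upperHalf)
    (hint : ∀ x, IntegrableOn (fun y => ‖x - y‖ ^ (-a) * ω y) upperHalf)
    (hK : ∀ x, ∫ y in upperHalf, ‖x - y‖ ^ (-a) * ω y ≤ K) :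
    energy ω ≤ 8 / a * K * ∫ x in upperHalf, x.2 ^ a * ω x := by
  have hG0 : ∀ x ∈ upperHalf, ∀ y ∈ upperHalf, 0 ≤ G x y * ω x * ω y := fun x hx y hy =>
    mul_nonneg (mul_nonneg (G_nonneg hx hy) (hω x)) (hω y)
  have hinner : ∀ x ∈ upperHalf,
      ∫ y in upperHalf, G x y * ω x * ω y ≤ 16 / a * K * (x.2 ^ a * ω x) := by
    intro x hx
    have hx0 : 0 < x.2 := hx
    have hc : 0 ≤ 16 / a * x.2 ^ a * ω x := mul_nonneg (by positivity) (hω x)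
    calc ∫ y in upperHalf, G x y * ω x * ω y
        ≤ ∫ y in upperHalf, 16 / a * x.2 ^ a * ω x * (‖x - y‖ ^ (-a) * ω y) := by
          refine integral_mono_of_nonneg ((ae_restrict_mem measurableSet_upperHalf).mono (hG0 x hx))
            ((hint x).const_mul _) ((ae_restrict_mem measurableSet_upperHalf).mono fun y hy => ?_)
          have := mul_le_mul_of_nonneg_right (mul_le_mul_of_nonneg_right
            (G_le_rpow hx hy ha ha1) (hω x)) (hω y)
          simp only
          linarith
      _ = 16 / a * x.2 ^ a * ω x * ∫ y in upperHalf, ‖x - y‖ ^ (-a) * ω y := integral_const_mul _ _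
      _ ≤ 16 / a * x.2 ^ a * ω x * K := mul_le_mul_of_nonneg_left (hK x) hc
      _ = _ := by ring
  have houter := integral_mono_of_nonneg
    ((ae_restrict_mem measurableSet_upperHalf).mono fun x hx =>
      setIntegral_nonneg measurableSet_upperHalf (hG0 x hx))
    ((integrableOn_snd_rpow_mul ha.le ha1 hω h1 h3).const_mul (16 / a * K))
    ((ae_restrict_mem measurableSet_upperHalf).mono hinner)
  rw [integral_const_mul] at houter
  unfold energy
  calc _ ≤ 1 / 2 * (16 / a * K * ∫ x in upperHalf, x.2 ^ a * ω x) := by gcongr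
    _ = _ := by ring

theorem kinetic_energy_bound (p : ℝ) (hp : 1 < p) :
    ∃ C : ℝ, 0 < C ∧ ∀ ω : ℝ × ℝ → ℝ, (∀ y, 0 ≤ ω y) →
      IntegrableOn ω upperHalf → IntegrableOn (fun y => ω y ^ p) upperHalf →
      IntegrableOn (fun y => y.2 * ω y) upperHalf →
      energy ω ≤
        C * (∫ y in upperHalf, y.2 * ω y) ^ (1 - 1/p) *
          (∫ y in upperHalf, ω y) ^ (1/2 + 1/p) *
          ((∫ y in upperHalf, ω y ^ p) ^ (1/p)) ^ (1/2 : ℝ) := by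
  have ha : 0 < 1 - 1 / p := by
    rw [sub_pos, div_lt_one (by linarith)]
    exact hp
  have hip : 0 < 1 / p := by
    have : 0 < p := by linarith
    positivity
  refine ⟨8 / (1 - 1 / p) *
    (1 + (2 * volume.real (Metric.ball (0 : ℝ × ℝ) 1)) ^ (1 - 1 / p)), by positivity, ?_⟩
  intro ω hω h1 h2 h3
  have hI : 0 ≤ ∫ y in upperHalf, y.2 * ω y :=
    setIntegral_nonneg measurableSet_upperHalf fun y hy => mul_nonneg (le_of_lt hy) (hω y)
  have hN : 0 ≤ ∫ y in upperHalf, ω y := integral_nonneg hω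
  have hωp : ∀ y, 0 ≤ ω y ^ p := fun y => Real.rpow_nonneg (hω y) _
  have hM : 0 ≤ ∫ y in upperHalf, ω y ^ p := integral_nonneg hωp
  by_cases hzero : ∀ᵐ y ∂volume.restrict upperHalf, ω y = 0
  · rw [energy_eq_zero hzero]
    positivity
  have hN' : 0 < ∫ y in upperHalf, ω y := by
    refine hN.lt_of_ne' fun h => hzero ?_
    exact (integral_eq_zero_iff_of_nonneg hω h1).1 h
  have hM' : 0 < ∫ y in upperHalf, ω y ^ p := by
    refine hM.lt_of_ne' fun h => hzero ?_
    filter_upwards [(integral_eq_zero_iff_of_nonneg hωp h2).1 h] with y hy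
    exact (Real.rpow_eq_zero (hω y) (by linarith)).1 hy
  have hE := energy_le_of_potential_le ha (by linarith) hω h1 h3
    (fun x => (integral_norm_rpow_mul_le hp hω h1 h2 x one_pos).1)
    (integral_norm_rpow_mul_le_sqrt hp hω h1 h2 hN' hM')
  have hH := integral_snd_rpow_mul_le hp hω h1 h3
  refine hE.trans ((mul_le_mul_of_nonneg_left hH (by positivity)).trans (le_of_eq ?_))
  rw [Real.rpow_add hN']
  ring
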